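/- (Feasibility transfer, the core of the proof of Proposition 1) Suppose e : Fin N → ℝ satisfies e_i ≥ 0 for all i, and the triple (W^c, W^L + e, u) is feasible for problem (7). Define the scheduler v by v_i(t) = 1 if (u_i(t) = 1 and W_i(t) > W_i^L + e_i) or W_i^L ≤ W_i(t) ≤ W_i^L + e_i, and v_i(t) = 0 otherwise. Then the triple (W^c + Σ_i e_i, W^L, v) is feasible for problem (7), and its objective value equals that of (W^c, W^L + e, u). -/

import Mathlib

open Filter Finset

noncomputable section

/-- `{0,1}`-valued real indicator of a proposition. -/
def ind (P : Prop) [Decidable P] : ℝ := if P then 1 else 0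

/-- Positive part `[x]^+ = max(x,0)`. -/
def pos (x : ℝ) : ℝ := max x 0

/-- A scheduler takes values in `{0,1}`. -/
def IsScheduler {N : ℕ} (u : ℕ → Fin N → ℝ) : Prop :=
  ∀ t i, u t i = 0 ∨ u t i = 1

/-- Feasibility of the triple `(Wc, Wr, u)` for problem (7). -/
def Feasible7 {N : ℕ} (W : ℕ → Fin N → ℝ) (PH : Fin N → ℝ) (F : Fin N → ℝ → ℝ)
    (WL : Fin N → ℝ) (Wc : ℝ) (Wr : Fin N → ℝ) (u : ℕ → Fin N → ℝ) : Prop :=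
  (∀ i, PH i - F i (Wr i) ≤
      Filter.liminf (fun T : ℕ =>
        (1 / (T : ℝ)) * ∑ t ∈ Finset.Icc 1 T, u t i * ind (Wr i < W t i)) Filter.atTop) ∧
  (∀ i, WL i ≤ Wr i) ∧
  (∀ t, ∑ i, u t i * pos (W t i - Wr i) ≤ Wc + ∑ i, pos (Wr i - W t i)) ∧
  IsScheduler u

/-- Objective value of problem (7). -/
def objective7 {N : ℕ} (Wc : ℝ) (Wr : Fin N → ℝ) : ℝ := Wc + ∑ i, Wr i

/-- Optimality of the triple `(Wc, Wr, u)` for problem (7). -/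
def Optimal7 {N : ℕ} (W : ℕ → Fin N → ℝ) (PH : Fin N → ℝ) (F : Fin N → ℝ → ℝ)
    (WL : Fin N → ℝ) (Wc : ℝ) (Wr : Fin N → ℝ) (u : ℕ → Fin N → ℝ) : Prop :=
  Feasible7 W PH F WL Wc Wr u ∧
  ∀ (Wc' : ℝ) (Wr' : Fin N → ℝ) (u' : ℕ → Fin N → ℝ),
    Feasible7 W PH F WL Wc' Wr' u' → objective7 Wc Wr ≤ objective7 Wc' Wr'

/-- Feasibility of the pair `(Wc, u)` for problem (10), where `P^M_i = F_i(W_i^L)`. -/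
def Feasible10 {N : ℕ} (W : ℕ → Fin N → ℝ) (PH : Fin N → ℝ) (F : Fin N → ℝ → ℝ)
    (WL : Fin N → ℝ) (Wc : ℝ) (u : ℕ → Fin N → ℝ) : Prop :=
  (∀ i, PH i - F i (WL i) ≤
      Filter.liminf (fun T : ℕ =>
        (1 / (T : ℝ)) * ∑ t ∈ Finset.Icc 1 T, u t i * ind (WL i < W t i)) Filter.atTop) ∧
  (∀ t, ∑ i, u t i * pos (W t i - WL i) ≤ Wc + ∑ i, pos (WL i - W t i)) ∧
  IsScheduler u

/-- Optimality of the pair `(Wc, u)` for problem (10); the objective is `Wc`. -/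
def Optimal10 {N : ℕ} (W : ℕ → Fin N → ℝ) (PH : Fin N → ℝ) (F : Fin N → ℝ → ℝ)
    (WL : Fin N → ℝ) (Wc : ℝ) (u : ℕ → Fin N → ℝ) : Prop :=
  Feasible10 W PH F WL Wc u ∧
  ∀ (Wc' : ℝ) (u' : ℕ → Fin N → ℝ), Feasible10 W PH F WL Wc' u' → Wc ≤ Wc'

/-- With threshold `a + b`, service at rate `x` above the threshold together with the demands
in `(a, a + b]` is exactly the service of the transferred scheduler above the threshold `a`. -/
lemma ind_transfer_mul_ind {x w a b : ℝ} (hx : x = 0 ∨ x = 1) (hb : 0 ≤ b) :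
    ind ((x = 1 ∧ a + b < w) ∨ (a ≤ w ∧ w ≤ a + b)) * ind (a < w) =
      x * ind (a + b < w) + (ind (w ≤ a + b) - ind (w ≤ a)) := by
  unfold ind
  rcases hx with rfl | rfl <;> split_ifs <;> grind

/-- Lowering the threshold from `a + b` to `a` costs at most `b` of capacity. -/
lemma ind_transfer_mul_pos_add_pos_le {x w a b : ℝ} (hx : x = 0 ∨ x = 1) (hb : 0 ≤ b) :
    ind ((x = 1 ∧ a + b < w) ∨ (a ≤ w ∧ w ≤ a + b)) * pos (w - a) + pos (a + b - w) ≤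
      x * pos (w - (a + b)) + b + pos (a - w) := by
  unfold ind pos
  rcases hx with rfl | rfl <;> split_ifs <;> grind

/-- Averages over `1, …, T` of a sequence with values in `[0, 1]` lie in `[0, 1]`. -/
lemma average_mem_Icc {f : ℕ → ℝ} (hf : ∀ t, f t ∈ Set.Icc (0 : ℝ) 1) (T : ℕ) :
    (1 / (T : ℝ)) * ∑ t ∈ Finset.Icc 1 T, f t ∈ Set.Icc (0 : ℝ) 1 := by
  have h0 : 0 ≤ ∑ t ∈ Finset.Icc 1 T, f t := Finset.sum_nonneg fun t _ => (hf t).1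
  have h1 : ∑ t ∈ Finset.Icc 1 T, f t ≤ T := by
    simpa using Finset.sum_le_card_nsmul (Finset.Icc 1 T) f 1 fun t _ => (hf t).2
  refine ⟨by positivity, ?_⟩
  rw [one_div, inv_mul_eq_div]
  exact div_le_one_of_le₀ h1 (Nat.cast_nonneg T)

/-- Adding a convergent sequence shifts a lower bound on the limit inferior by its limit. -/
lemma add_le_liminf_add_of_tendsto {f g : ℕ → ℝ} {c l : ℝ}
    (hf : ∀ T, f T ∈ Set.Icc (0 : ℝ) 1) (hg : Tendsto g atTop (nhds l))
    (hc : c ≤ liminf f atTop) : c + l ≤ liminf (fun T => f T + g T) atTop := by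
  have hfa : IsBoundedUnder (· ≤ ·) atTop f := isBoundedUnder_of ⟨1, fun T => (hf T).2⟩
  have hfb : IsBoundedUnder (· ≥ ·) atTop f := isBoundedUnder_of ⟨0, fun T => (hf T).1⟩
  calc c + l ≤ liminf f atTop + liminf g atTop := by rw [hg.liminf_eq]; gcongr
    _ ≤ liminf (f + g) atTop :=
      le_liminf_add hfb hfa hg.isBoundedUnder_ge hg.isCoboundedUnder_ge

/-- Feasibility transfer, the core of the proof of Proposition 1. -/
theorem feasibility_transfer {N : ℕ} (W : ℕ → Fin N → ℝ) (PH PL : Fin N → ℝ) (F : Fin N → ℝ → ℝ)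
    (hF : ∀ i x, Filter.Tendsto
      (fun T : ℕ => (1 / (T : ℝ)) * ∑ t ∈ Finset.Icc 1 T, ind (W t i ≤ x))
      Filter.atTop (nhds (F i x)))
    (WL : Fin N → ℝ) (hWL : ∀ i, PL i ≤ F i (WL i))
    (e : Fin N → ℝ) (he : ∀ i, 0 ≤ e i)
    (Wc : ℝ) (u : ℕ → Fin N → ℝ)
    (hfeas : Feasible7 W PH F WL Wc (fun i => WL i + e i) u) :
    Feasible7 W PH F WL (Wc + ∑ i, e i) WL
      (fun t i => ind ((u t i = 1 ∧ WL i + e i < W t i) ∨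
        (WL i ≤ W t i ∧ W t i ≤ WL i + e i))) ∧
    objective7 (Wc + ∑ i, e i) WL = objective7 Wc (fun i => WL i + e i) := by
  obtain ⟨hlim, -, hcap, hu⟩ := hfeas
  refine ⟨⟨fun i => ?_, fun i => le_rfl, fun t => ?_, fun t i => ?_⟩, ?_⟩
  · have hmem : ∀ t, u t i * ind (WL i + e i < W t i) ∈ Set.Icc (0 : ℝ) 1 := fun t => by
      unfold ind
      rcases hu t i with h | h <;> rw [h] <;> split_ifs <;> simp
    have h := add_le_liminf_add_of_tendsto (average_mem_Icc hmem)
      ((hF i (WL i + e i)).sub (hF i (WL i))) (hlim i)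
    simp only [ind_transfer_mul_ind (hu _ i) (he i), Finset.sum_add_distrib,
      Finset.sum_sub_distrib, mul_add, mul_sub]
    linarith
  · have h := Finset.sum_le_sum fun i (_ : i ∈ Finset.univ) =>
      ind_transfer_mul_pos_add_pos_le (w := W t i) (a := WL i) (hu t i) (he i)
    simp only [Finset.sum_add_distrib] at h
    linarith [hcap t]
  · simp only [ind]
    split_ifs <;> simp
  · simp only [objective7, Finset.sum_add_distrib]
    ring
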